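/- arXiv:1104.1024 — 2 statements merged into one kernel-verified Lean document; each statement's English description precedes it below -/
import Mathlib

section
/- For every n ≥ 1, Λ_n = ⋃_{v ∈ 𝒫_n} f_v([0,1]²), where for a path v = (v₁,…,v_n) ∈ 𝒫_n, f_v = f_{v₁} ∘ ⋯ ∘ f_{v_n}. -/
noncomputable section
attribute [local instance] Classical.propDecidable

namespace HierGraph

open Finset MeasureTheory ProbabilityTheory

variable {N : ℕ}

/-- The degree of a vertex in a finite simple graph. -/
def degH {α : Type*} [Fintype α] (H : SimpleGraph α) (v : α) : ℕ :=
  (univ.filter fun w => H.Adj v w).card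

/-- The length `|x ∧ y|` of the longest common prefix of two words. -/
def prefixLen {n : ℕ} (x y : Fin n → Fin N) : ℕ :=
  (univ.filter fun i : Fin n => ∀ j : Fin n, j ≤ i → x j = y j).card

/-- The postfix of `x` starting at position `k` has constant type
(`t = true` ↔ all its letters lie in `V1`). -/
def postfixType (V1 : Finset (Fin N)) {n : ℕ} (k : ℕ) (x : Fin n → Fin N) (t : Bool) : Prop :=
  ∀ i : Fin n, k ≤ i.val → (x i ∈ V1 ↔ t = true)

/-- The edge relation of the graph `Gₙ` (loops included): `x = y`, or the two postfixes
after the common prefix have types `{1,2}` and corresponding letters are adjacent in `G`. -/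
def EdgeRel (G : SimpleGraph (Fin N)) (V1 : Finset (Fin N)) {n : ℕ} (x y : Fin n → Fin N) :
    Prop :=
  x = y ∨
    ((∃ t : Bool, postfixType V1 (prefixLen x y) x t ∧ postfixType V1 (prefixLen x y) y (!t)) ∧
      ∀ i : Fin n, prefixLen x y ≤ i.val → G.Adj (x i) (y i))

/-- The degree of a vertex of `Gₙ`, the loop counting `2`. -/
def degGn (G : SimpleGraph (Fin N)) (V1 : Finset (Fin N)) {n : ℕ} (x : Fin n → Fin N) : ℕ :=
  2 + (univ.filter fun y : Fin n → Fin N => y ≠ x ∧ EdgeRel G V1 x y).card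

/-- `ℓ(x)`: the length of the longest suffix of `x` of constant (nonzero) type. -/
def ell (V1 : Finset (Fin N)) {n : ℕ} (x : Fin n → Fin N) : ℕ :=
  ((Finset.Icc 1 n).filter fun i =>
    (∀ j : Fin n, n - i ≤ j.val → x j ∈ V1) ∨ ∀ j : Fin n, n - i ≤ j.val → x j ∉ V1).sup id

/-- `S(x) = Σ_{r=0}^{ℓ(x)-1} Π_{j=1}^{r} deg(x_{n-j})`. -/
def Sx (G : SimpleGraph (Fin N)) (V1 : Finset (Fin N)) {n : ℕ} (hn : 0 < n)
    (x : Fin n → Fin N) : ℕ :=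
  ∑ r ∈ Finset.range (ell V1 x), ∏ j ∈ Finset.Icc 1 r, degH G (x ⟨n - 1 - j, by omega⟩)

/-- The simple graph `Gₙ` (loops removed). -/
def GnSimple (G : SimpleGraph (Fin N)) (V1 : Finset (Fin N)) (n : ℕ) :
    SimpleGraph (Fin n → Fin N) :=
  SimpleGraph.fromRel (EdgeRel G V1)

/-- The diameter of a finite graph: the maximal graph distance. -/
def fdiam {α : Type*} [Fintype α] (H : SimpleGraph α) : ℕ :=
  univ.sup fun p : α × α => H.dist p.1 p.2

/-- The number of maximal constant-type blocks of the postfix of `x` starting at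
position `k` (`k < n`). -/
def blockCount (V1 : Finset (Fin N)) {n : ℕ} (k : ℕ) (x : Fin n → Fin N) : ℕ :=
  1 + (univ.filter fun i : Fin n =>
        k ≤ i.val ∧ ∃ h : i.val + 1 < n, ¬((x i ∈ V1) ↔ x ⟨i.val + 1, h⟩ ∈ V1)).card

/-- The left endpoint of the `N`-adic interval `I_x`. -/
def Ipt {n : ℕ} (x : Fin n → Fin N) : ℝ := ∑ r : Fin n, (x r : ℝ) / (N : ℝ) ^ (r.val + 1)

/-- The `N`-adic interval `I_x ⊆ [0,1]`. -/
def Iset {n : ℕ} (x : Fin n → Fin N) : Set ℝ := Set.Icc (Ipt x) (Ipt x + 1 / (N : ℝ) ^ n)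

/-- The level-`n` square `Q_{(x,y)} = I_x × I_y`. -/
def Qset {n : ℕ} (x y : Fin n → Fin N) : Set (ℝ × ℝ) := Iset x ×ˢ Iset y

/-- `Λₙ`: the embedded adjacency matrix of `Gₙ` in the unit square. -/
def Lam (G : SimpleGraph (Fin N)) (V1 : Finset (Fin N)) (n : ℕ) : Set (ℝ × ℝ) :=
  ⋃ (p : (Fin n → Fin N) × (Fin n → Fin N)) (_ : EdgeRel G V1 p.1 p.2), Qset p.1 p.2

/-- `Λ = ⋂_{n ≥ 1} Λₙ`. -/
def LamInf (G : SimpleGraph (Fin N)) (V1 : Finset (Fin N)) : Set (ℝ × ℝ) :=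
  ⋂ (n : ℕ) (_ : 1 ≤ n), Lam G V1 n

/-- The homothety `f_v(a,b) = ((a,b) + v)/N` for `v ∈ Σ₁ × Σ₁`. -/
def fmap (N : ℕ) (v : Fin N × Fin N) : ℝ × ℝ → ℝ × ℝ :=
  fun p => ((p.1 + (v.1 : ℝ)) / N, (p.2 + (v.2 : ℝ)) / N)

/-- `f_v = f_{v₁} ∘ ⋯ ∘ f_{vₙ}` for a word `v` over `Σ₁ × Σ₁` (identity for the empty word). -/
def fpath {n : ℕ} (v : Fin n → Fin N × Fin N) : ℝ × ℝ → ℝ × ℝ :=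
  (List.ofFn fun i => fmap N (v i)).foldr (· ∘ ·) id

/-- The unit square `[0,1]²`. -/
def unitSq : Set (ℝ × ℝ) := Set.Icc (0 : ℝ) 1 ×ˢ Set.Icc (0 : ℝ) 1

/-- The diagonal `{(t,t) : t ∈ [0,1]}`. -/
def DiagSet : Set (ℝ × ℝ) := (fun t : ℝ => (t, t)) '' Set.Icc (0 : ℝ) 1

/-- `V_dd`, the diagonal vertices of the directed graph `𝒢`. -/
def Vdd (v : Fin N × Fin N) : Prop := v.1 = v.2

/-- `V₁₂`, vertices of `𝒢` coming from edges of `G` directed from `V₁` to `V₂`. -/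
def V12 (G : SimpleGraph (Fin N)) (V1 : Finset (Fin N)) (v : Fin N × Fin N) : Prop :=
  v.1 ∈ V1 ∧ v.2 ∉ V1 ∧ G.Adj v.1 v.2

/-- `V₂₁`, vertices of `𝒢` coming from edges of `G` directed from `V₂` to `V₁`. -/
def V21 (G : SimpleGraph (Fin N)) (V1 : Finset (Fin N)) (v : Fin N × Fin N) : Prop :=
  v.1 ∉ V1 ∧ v.2 ∈ V1 ∧ G.Adj v.1 v.2

/-- Vertices of the directed graph `𝒢`. -/
def calGVert (G : SimpleGraph (Fin N)) (V1 : Finset (Fin N)) (v : Fin N × Fin N) : Prop :=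
  Vdd v ∨ V12 G V1 v ∨ V21 G V1 v

/-- Directed edges of `𝒢`: all pairs (loops included) within each of `V_dd`, `V₁₂`, `V₂₁`,
plus one edge from each vertex of `V_dd` to each vertex of `V₁₂ ∪ V₂₁`. -/
def calGEdge (G : SimpleGraph (Fin N)) (V1 : Finset (Fin N)) (u v : Fin N × Fin N) : Prop :=
  (Vdd u ∧ Vdd v) ∨ (V12 G V1 u ∧ V12 G V1 v) ∨ (V21 G V1 u ∧ V21 G V1 v) ∨
    (Vdd u ∧ (V12 G V1 v ∨ V21 G V1 v))

/-- `v ∈ 𝒫ₙ`: `v` is a directed path of length `n` in `𝒢`. -/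
def IsPathCalG (G : SimpleGraph (Fin N)) (V1 : Finset (Fin N)) {n : ℕ}
    (v : Fin n → Fin N × Fin N) : Prop :=
  (∀ i, calGVert G V1 (v i)) ∧
    ∀ i j : Fin n, (j : ℕ) = (i : ℕ) + 1 → calGEdge G V1 (v i) (v j)

/-- Non-loop edges of `Gₙ`, i.e. edges of `G'ₙ`. -/
def GnEdge' (G : SimpleGraph (Fin N)) (V1 : Finset (Fin N)) {n : ℕ} (x y : Fin n → Fin N) :
    Prop :=
  x ≠ y ∧ EdgeRel G V1 x y

/-- The extra edges `RE(Ĝₙ)`: the two words agree except in the last letter, and the last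
letters form an extra edge (an edge of `R`). -/
def REn (R : SimpleGraph (Fin N)) {n : ℕ} (x y : Fin n → Fin N) : Prop :=
  ∃ h : 0 < n, (∀ i : Fin n, i.val + 1 < n → x i = y i) ∧
    R.Adj (x ⟨n - 1, Nat.sub_lt h Nat.one_pos⟩) (y ⟨n - 1, Nat.sub_lt h Nat.one_pos⟩)

/-- Adjacency in `Ĝₙ`. -/
def hatAdj (G R : SimpleGraph (Fin N)) (V1 : Finset (Fin N)) {n : ℕ} (x y : Fin n → Fin N) :
    Prop :=
  GnEdge' G V1 x y ∨ REn R x y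

/-- The graph `Ĝₙ`. -/
def HatGn (G R : SimpleGraph (Fin N)) (V1 : Finset (Fin N)) (n : ℕ) :
    SimpleGraph (Fin n → Fin N) :=
  SimpleGraph.fromRel (hatAdj G R V1)

/-- Property R: every `x ∈ Σ₁` lies in a triangle having two edges in `E(G)` and
one extra edge (an edge of `R`). -/
def PropertyR (G R : SimpleGraph (Fin N)) : Prop :=
  ∀ x : Fin N, ∃ y z : Fin N,
    (G.Adj x y ∧ G.Adj x z ∧ R.Adj y z) ∨ (G.Adj x y ∧ R.Adj x z ∧ G.Adj y z) ∨
      (R.Adj x y ∧ G.Adj x z ∧ G.Adj y z)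

/-- Exactly two of the three edges of the triangle `(x,y,z)` are non-loop edges of `Gₙ`. -/
def exactlyTwoG (G : SimpleGraph (Fin N)) (V1 : Finset (Fin N)) {n : ℕ}
    (x y z : Fin n → Fin N) : Prop :=
  (GnEdge' G V1 x y ∧ GnEdge' G V1 x z ∧ ¬GnEdge' G V1 y z) ∨
    (GnEdge' G V1 x y ∧ ¬GnEdge' G V1 x z ∧ GnEdge' G V1 y z) ∨
      (¬GnEdge' G V1 x y ∧ GnEdge' G V1 x z ∧ GnEdge' G V1 y z)

/-- `Δₙ¹(x)` (counted over ordered pairs): class-1 regular triangles at `x` in `Ĝₙ`. -/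
def numTri1 (G R : SimpleGraph (Fin N)) (V1 : Finset (Fin N)) {n : ℕ} (x : Fin n → Fin N) :
    ℕ :=
  (univ.filter fun p : (Fin n → Fin N) × (Fin n → Fin N) =>
    GnEdge' G V1 x p.1 ∧ GnEdge' G V1 x p.2 ∧ REn R p.1 p.2).card

/-- `Δₙ²(x)` (counted over ordered pairs): class-2 regular triangles at `x` in `Ĝₙ`. -/
def numTri2 (G R : SimpleGraph (Fin N)) (V1 : Finset (Fin N)) {n : ℕ} (x : Fin n → Fin N) :
    ℕ :=
  (univ.filter fun p : (Fin n → Fin N) × (Fin n → Fin N) =>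
    GnEdge' G V1 x p.1 ∧ REn R x p.2 ∧ GnEdge' G V1 p.1 p.2).card

/-- `Δₙ^{ir}(x)` (counted over ordered pairs): irregular triangles at `x` in `Ĝₙ`. -/
def numTriIr (G R : SimpleGraph (Fin N)) (V1 : Finset (Fin N)) {n : ℕ} (x : Fin n → Fin N) :
    ℕ :=
  (univ.filter fun p : (Fin n → Fin N) × (Fin n → Fin N) =>
    hatAdj G R V1 x p.1 ∧ hatAdj G R V1 x p.2 ∧ hatAdj G R V1 p.1 p.2 ∧
      ¬exactlyTwoG G V1 x p.1 p.2).card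

/-- Exactly two of the three edges of the triangle `(x,y,z)` are edges of `G`. -/
def exactlyTwoB (G : SimpleGraph (Fin N)) (x y z : Fin N) : Prop :=
  (G.Adj x y ∧ G.Adj x z ∧ ¬G.Adj y z) ∨ (G.Adj x y ∧ ¬G.Adj x z ∧ G.Adj y z) ∨
    (¬G.Adj x y ∧ G.Adj x z ∧ G.Adj y z)

/-- `Δ¹(z)` (counted over ordered pairs): class-1 regular triangles at `z` in `Ĝ = G ⊔ R`. -/
def numTri1B (G R : SimpleGraph (Fin N)) (z : Fin N) : ℕ :=
  (univ.filter fun p : Fin N × Fin N => G.Adj z p.1 ∧ G.Adj z p.2 ∧ R.Adj p.1 p.2).card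

/-- `Δ²(z)` (counted over ordered pairs): class-2 regular triangles at `z` in `Ĝ = G ⊔ R`. -/
def numTri2B (G R : SimpleGraph (Fin N)) (z : Fin N) : ℕ :=
  (univ.filter fun p : Fin N × Fin N => G.Adj z p.1 ∧ R.Adj z p.2 ∧ G.Adj p.1 p.2).card

/-- `Δ^{ir}(z)` (counted over ordered pairs): irregular triangles at `z` in `Ĝ = G ⊔ R`. -/
def numTriIrB (G R : SimpleGraph (Fin N)) (z : Fin N) : ℕ :=
  (univ.filter fun p : Fin N × Fin N =>
    (G ⊔ R).Adj z p.1 ∧ (G ⊔ R).Adj z p.2 ∧ (G ⊔ R).Adj p.1 p.2 ∧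
      ¬exactlyTwoB G z p.1 p.2).card

/-- The number of ordered pairs of neighbors of `x` that are adjacent,
i.e. twice the number of triangles containing `x`. -/
def triOrd {α : Type*} [Fintype α] (H : SimpleGraph α) (x : α) : ℕ :=
  (univ.filter fun p : α × α => H.Adj x p.1 ∧ H.Adj x p.2 ∧ H.Adj p.1 p.2).card

/-- The local clustering coefficient
`C_x = #{edges between neighbors of x} / (deg x choose 2)`. -/
def clustering {α : Type*} [Fintype α] (H : SimpleGraph α) (x : α) : ℝ :=
  (triOrd H x : ℝ) / ((degH H x : ℝ) * ((degH H x : ℝ) - 1))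

/-- The degree of vertex `i` in the random graph `Gₙʳ` built from the digit variables `D`
(neighbors `j ≠ i` are counted). -/
def degR (G : SimpleGraph (Fin N)) (V1 : Finset (Fin N)) {n M : ℕ} {Ω : Type*}
    (D : Fin M → Fin n → Ω → Fin N) (i : Fin M) (ω : Ω) : ℕ :=
  (univ.filter fun j : Fin M => j ≠ i ∧
    EdgeRel G V1 (fun k => D i k ω) (fun k => D j k ω)).card

/-- `t_k = (d₁^{k+1} - 1)/(d₁ - 1) + 1`. -/
def tkD (d₁ k : ℕ) : ℝ := ((d₁ : ℝ) ^ (k + 1) - 1) / ((d₁ : ℝ) - 1) + 1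

theorem lt_prefixLen_iff {n : ℕ} (x y : Fin n → Fin N) (i : Fin n) :
    i.val < prefixLen x y ↔ ∀ j ≤ i, x j = y j := by
  constructor
  · intro h
    by_contra hi
    have hsub : (univ.filter fun i : Fin n => ∀ j : Fin n, j ≤ i → x j = y j) ⊆ Finset.Iio i := by
      intro m hm
      rw [Finset.mem_Iio]
      by_contra hmi
      exact hi fun j hj => (Finset.mem_filter.1 hm).2 j (hj.trans (not_lt.1 hmi))
    have hcard := Finset.card_le_card hsub
    rw [Fin.card_Iio] at hcard
    exact absurd h (not_lt.2 hcard)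
  · intro h
    have hsub : Finset.Iic i ⊆ (univ.filter fun i : Fin n => ∀ j : Fin n, j ≤ i → x j = y j) := by
      intro m hm
      exact Finset.mem_filter.2
        ⟨Finset.mem_univ _, fun j hj => h j (hj.trans (Finset.mem_Iic.1 hm))⟩
    have hcard := Finset.card_le_card hsub
    rw [Fin.card_Iic] at hcard
    exact hcard

theorem forall_ge_of_succ {n : ℕ} {P : Fin n → Prop}
    (hP : ∀ i j : Fin n, (j : ℕ) = (i : ℕ) + 1 → P i → P j) {i j : Fin n} (hij : i ≤ j)
    (hi : P i) : P j := by
  obtain ⟨j, hj⟩ := j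
  induction j, (show i.val ≤ j from hij) using Nat.le_induction with
  | base => exact hi
  | succ m hm ih => exact hP ⟨m, by omega⟩ _ rfl (ih (by omega) hm)

theorem not_Vdd_of_adj {G : SimpleGraph (Fin N)} {v : Fin N × Fin N} (h : G.Adj v.1 v.2) :
    ¬ Vdd v := h.ne

section Paths

variable {G : SimpleGraph (Fin N)} {V1 : Finset (Fin N)} {n : ℕ} {v : Fin n → Fin N × Fin N}

theorem IsPathCalG.V12_of_le (hv : IsPathCalG G V1 v) {i j : Fin n} (hij : i ≤ j)
    (hi : V12 G V1 (v i)) : V12 G V1 (v j) := by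
  refine forall_ge_of_succ (P := fun i => V12 G V1 (v i)) (fun a b hab ha => ?_) hij hi
  have hd := not_Vdd_of_adj ha.2.2
  rcases hv.2 a b hab with h | h | h | h
  · exact absurd h.1 hd
  · exact h.2
  · exact absurd ha.1 h.1.1
  · exact absurd h.1 hd

theorem IsPathCalG.V21_of_le (hv : IsPathCalG G V1 v) {i j : Fin n} (hij : i ≤ j)
    (hi : V21 G V1 (v i)) : V21 G V1 (v j) := by
  refine forall_ge_of_succ (P := fun i => V21 G V1 (v i)) (fun a b hab ha => ?_) hij hi
  have hd := not_Vdd_of_adj ha.2.2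
  rcases hv.2 a b hab with h | h | h | h
  · exact absurd h.1 hd
  · exact absurd h.1.1 ha.1
  · exact h.2
  · exact absurd h.1 hd

theorem IsPathCalG.Vdd_of_le (hv : IsPathCalG G V1 v) {i j : Fin n} (hij : i ≤ j)
    (hj : Vdd (v j)) : Vdd (v i) := by
  rcases hv.1 i with h | h | h
  · exact h
  · exact absurd hj (not_Vdd_of_adj (hv.V12_of_le hij h).2.2)
  · exact absurd hj (not_Vdd_of_adj (hv.V21_of_le hij h).2.2)

end Paths

theorem edgeRel_iff_isPathCalG (G : SimpleGraph (Fin N)) (V1 : Finset (Fin N)) {n : ℕ}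
    (x y : Fin n → Fin N) :
    EdgeRel G V1 x y ↔ IsPathCalG G V1 (fun i => (x i, y i)) := by
  constructor
  · rintro (rfl | ⟨⟨t, hx, hy⟩, hadj⟩)
    · exact ⟨fun i => Or.inl rfl, fun i j _ => Or.inl ⟨rfl, rfl⟩⟩
    · have hlow : ∀ i : Fin n, i.val < prefixLen x y → Vdd (x i, y i) := fun i hi =>
        (lt_prefixLen_iff x y i).1 hi i le_rfl
      have hhigh : (∀ i : Fin n, prefixLen x y ≤ i.val → V12 G V1 (x i, y i)) ∨
          ∀ i : Fin n, prefixLen x y ≤ i.val → V21 G V1 (x i, y i) := by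
        cases t with
        | true =>
          exact Or.inl fun i hi =>
            ⟨(hx i hi).2 rfl, fun h => absurd ((hy i hi).1 h) (by simp), hadj i hi⟩
        | false =>
          exact Or.inr fun i hi =>
            ⟨fun h => absurd ((hx i hi).1 h) (by simp), (hy i hi).2 rfl, hadj i hi⟩
      refine ⟨fun i => ?_, fun i j hij => ?_⟩
      · rcases lt_or_ge i.val (prefixLen x y) with hi | hi
        · exact Or.inl (hlow i hi)
        · exact Or.inr (hhigh.imp (fun h => h i hi) fun h => h i hi)
      · rcases lt_or_ge j.val (prefixLen x y) with hj | hj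
        · exact Or.inl ⟨hlow i (by omega), hlow j hj⟩
        rcases lt_or_ge i.val (prefixLen x y) with hi | hi
        · exact Or.inr (Or.inr (Or.inr
            ⟨hlow i hi, hhigh.imp (fun h => h j hj) fun h => h j hj⟩))
        · rcases hhigh with h | h
          · exact Or.inr (Or.inl ⟨h i hi, h j hj⟩)
          · exact Or.inr (Or.inr (Or.inl ⟨h i hi, h j hj⟩))
  · intro hv
    have hdd : ∀ i : Fin n, i.val < prefixLen x y ↔ Vdd (x i, y i) := fun i =>
      (lt_prefixLen_iff x y i).trans
        ⟨fun h => h i le_rfl, fun h j hj => hv.Vdd_of_le hj h⟩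
    rcases le_or_gt n (prefixLen x y) with hn | hn
    · exact Or.inl (funext fun i => (hdd i).1 (i.isLt.trans_le hn))
    · refine Or.inr ?_
      rcases hv.1 ⟨prefixLen x y, hn⟩ with h | h | h
      · exact absurd ((hdd _).2 h) (lt_irrefl _)
      · have hk : ∀ i : Fin n, prefixLen x y ≤ i.val → V12 G V1 (x i, y i) := fun i hi =>
          hv.V12_of_le (show (⟨prefixLen x y, hn⟩ : Fin n) ≤ i from hi) h
        exact ⟨⟨true, fun i hi => by simpa using (hk i hi).1,
          fun i hi => by simpa using (hk i hi).2.1⟩, fun i hi => (hk i hi).2.2⟩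
      · have hk : ∀ i : Fin n, prefixLen x y ≤ i.val → V21 G V1 (x i, y i) := fun i hi =>
          hv.V21_of_le (show (⟨prefixLen x y, hn⟩ : Fin n) ≤ i from hi) h
        exact ⟨⟨false, fun i hi => by simpa using (hk i hi).1,
          fun i hi => by simpa using (hk i hi).2.1⟩, fun i hi => (hk i hi).2.2⟩

theorem Ipt_succ {n : ℕ} (x : Fin (n + 1) → Fin N) :
    Ipt x = ((x 0 : ℝ) + Ipt fun i => x i.succ) / N := by
  simp only [Ipt, Fin.sum_univ_succ, Fin.val_zero, Fin.val_succ, zero_add, pow_one, add_div,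
    Finset.sum_div, div_div, ← pow_succ]

theorem fpath_apply {n : ℕ} (v : Fin n → Fin N × Fin N) (p : ℝ × ℝ) :
    fpath v p = (Ipt (fun i => (v i).1) + p.1 / (N : ℝ) ^ n,
      Ipt (fun i => (v i).2) + p.2 / (N : ℝ) ^ n) := by
  induction n with
  | zero => simp [fpath, Ipt]
  | succ n ih =>
    have hcons : fpath v p = fmap N (v 0) (fpath (fun i => v i.succ) p) := by
      simp [fpath, List.ofFn_succ]
    rw [hcons, ih, Ipt_succ, Ipt_succ]
    ext <;> simp only [fmap, add_div, div_div, pow_succ] <;> ring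

theorem mem_Icc_add_one_div_iff {a c t : ℝ} (hc : 0 < c) :
    t ∈ Set.Icc a (a + 1 / c) ↔ ∃ s ∈ Set.Icc (0 : ℝ) 1, a + s / c = t := by
  constructor
  · rintro ⟨h₁, h₂⟩
    refine ⟨(t - a) * c, ⟨mul_nonneg (sub_nonneg.2 h₁) hc.le, ?_⟩, ?_⟩
    · exact (le_div_iff₀ hc).1 (by linarith)
    · rw [mul_div_cancel_right₀ _ hc.ne', add_sub_cancel]
  · rintro ⟨s, ⟨h₀, h₁⟩, rfl⟩
    exact ⟨le_add_of_nonneg_right (by positivity), by gcongr⟩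

theorem image_fpath_unitSq (hN : 0 < N) {n : ℕ} (v : Fin n → Fin N × Fin N) :
    fpath v '' unitSq = Qset (fun i => (v i).1) (fun i => (v i).2) := by
  have hc : (0 : ℝ) < (N : ℝ) ^ n := by positivity
  ext ⟨a, b⟩
  simp only [Qset, Iset, Set.mem_prod, mem_Icc_add_one_div_iff hc, Set.mem_image, fpath_apply,
    unitSq, Prod.exists, Prod.mk.injEq]
  constructor
  · rintro ⟨s, t, ⟨hs, ht⟩, hsa, htb⟩
    exact ⟨⟨s, hs, hsa⟩, t, ht, htb⟩
  · rintro ⟨⟨s, hs, hsa⟩, t, ht, htb⟩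
    exact ⟨s, t, ⟨hs, ht⟩, hsa, htb⟩

/-- `Λₙ = ⋃_{v ∈ 𝒫ₙ} f_v([0,1]²)`. -/
theorem statement2 {N : ℕ} (G : SimpleGraph (Fin N)) (V1 : Finset (Fin N))
    (hV1 : V1.Nonempty) (hV2 : V1ᶜ.Nonempty)
    (hbip : ∀ a b : Fin N, G.Adj a b → (a ∈ V1 ↔ b ∉ V1))
    (n : ℕ) (hn : 0 < n) :
    Lam G V1 n
      = ⋃ (v : Fin n → Fin N × Fin N) (_ : IsPathCalG G V1 v), fpath v '' unitSq := by
  have hN : 0 < N := hV1.choose.pos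
  ext p
  simp only [Lam, Set.mem_iUnion, image_fpath_unitSq hN, exists_prop, Prod.exists,
    edgeRel_iff_isPathCalG]
  constructor
  · rintro ⟨x, y, hxy, hp⟩
    exact ⟨fun i => (x i, y i), hxy, hp⟩
  · rintro ⟨v, hv, hp⟩
    exact ⟨fun i => (v i).1, fun i => (v i).2, hv, hp⟩

end HierGraph
end
end

section
/- The Hausdorff dimension of Λ is dim_H Λ = max{ log|E(G)| / log N , 1 }, and moreover dim_H(Λ \ Diag) = log|E(G)| / log N, where Diag = {(x,x) : x ∈ [0,1]} and |E(G)| is the number of edges of the base graph G. -/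
noncomputable section
attribute [local instance] Classical.propDecidable

namespace HierGraph

open Finset MeasureTheory ProbabilityTheory

variable {N : ℕ}

/-- The integer whose base-`N` digits, most significant first, are the letters of `x`. -/
def wordVal {n : ℕ} (x : Fin n → Fin N) : ℕ := finFunctionFinEquiv (x ∘ Fin.rev)

lemma wordVal_injective {n : ℕ} : Function.Injective (wordVal : (Fin n → Fin N) → ℕ) :=
  Fin.val_injective.comp (finFunctionFinEquiv.injective.comp
    Fin.rev_surjective.injective_comp_right)

lemma wordVal_lt {n : ℕ} (x : Fin n → Fin N) : wordVal x < N ^ n :=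
  (finFunctionFinEquiv (x ∘ Fin.rev)).isLt

lemma Ipt_eq_wordVal_div (hN : 0 < N) {n : ℕ} (x : Fin n → Fin N) :
    Ipt x = (wordVal x : ℝ) / (N : ℝ) ^ n := by
  have hN' : (N : ℝ) ≠ 0 := by positivity
  rw [wordVal, finFunctionFinEquiv_apply, Ipt, ← Equiv.sum_comp Fin.revPerm]
  push_cast
  rw [Finset.sum_div]
  refine Finset.sum_congr rfl fun i _ => ?_
  have h : (N : ℝ) ^ n = (N : ℝ) ^ ((Fin.rev i : ℕ) + 1) * (N : ℝ) ^ (i : ℕ) := by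
    rw [← pow_add, Fin.val_rev]
    congr 1
    omega
  rw [Fin.revPerm_apply, Function.comp_apply, h]
  field_simp

lemma mem_Iset_iff (hN : 0 < N) {n : ℕ} (x : Fin n → Fin N) (z : ℝ) :
    z ∈ Iset x ↔ (wordVal x : ℝ) ≤ (N : ℝ) ^ n * z ∧ (N : ℝ) ^ n * z ≤ wordVal x + 1 := by
  have h : (0 : ℝ) < (N : ℝ) ^ n := by positivity
  rw [Iset, Set.mem_Icc, Ipt_eq_wordVal_div hN, ← add_div, div_le_iff₀' h, le_div_iff₀' h]

lemma Ipt_append {k m : ℕ} (x : Fin (k + m) → Fin N) :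
    Ipt x = Ipt (x ∘ Fin.castAdd m) + Ipt (x ∘ Fin.natAdd k) / (N : ℝ) ^ k := by
  simp only [Ipt, Fin.sum_univ_add, Finset.sum_div, Function.comp_apply, Fin.val_castAdd,
    Fin.val_natAdd, div_div, ← pow_add]
  congr 1
  refine Finset.sum_congr rfl fun i _ => ?_
  congr 2
  omega

lemma Iset_subset_prefix (hN : 0 < N) {k m : ℕ} (x : Fin (k + m) → Fin N) :
    Iset x ⊆ Iset (x ∘ Fin.castAdd m) := by
  have hk : (0 : ℝ) < (N : ℝ) ^ k := by positivity
  have hm : (0 : ℝ) < (N : ℝ) ^ m := by positivity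
  have hval : (wordVal (x ∘ Fin.natAdd k) : ℝ) + 1 ≤ (N : ℝ) ^ m := by
    exact_mod_cast wordVal_lt (x ∘ Fin.natAdd k)
  refine Set.Icc_subset_Icc ?_ ?_
  · rw [Ipt_append x, Ipt_eq_wordVal_div hN (x ∘ Fin.natAdd k)]
    exact le_add_of_nonneg_right (by positivity)
  · rw [Ipt_append x, Ipt_eq_wordVal_div hN (x ∘ Fin.natAdd k), add_assoc, pow_add]
    gcongr
    rw [div_div, mul_comm ((N : ℝ) ^ m), ← add_div]
    rw [div_le_div_iff₀ (by positivity) hk]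
    nlinarith

lemma ofDigits_mem_Iset (a : ℕ → Fin N) (n : ℕ) :
    Real.ofDigits a ∈ Iset (fun i : Fin n => a i) := by
  have h : Ipt (fun i : Fin n => a i) = ∑ i ∈ Finset.range n, Real.ofDigitsTerm a i := by
    rw [← Fin.sum_univ_eq_sum_range]
    rfl
  have hpos : (0 : ℝ) ≤ ((N : ℝ) ^ n)⁻¹ := by positivity
  rw [Iset, Set.mem_Icc, h, Real.ofDigits_eq_sum_add_ofDigits a n, one_div]
  exact ⟨le_add_of_nonneg_right (mul_nonneg hpos (Real.ofDigits_nonneg _)),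
    add_le_add_right (mul_le_of_le_one_right hpos (Real.ofDigits_le_one _)) _⟩

lemma dist_le_of_mem_Iset {n : ℕ} {x : Fin n → Fin N} {a b : ℝ} (ha : a ∈ Iset x)
    (hb : b ∈ Iset x) : dist a b ≤ 1 / (N : ℝ) ^ n :=
  (Real.dist_le_of_mem_Icc ha hb).trans_eq (by ring)

/-- The level-`n` words whose interval comes within `N⁻ⁿ` of the real number `c`. -/
def nearWords (n : ℕ) (c : ℝ) : Finset (Fin n → Fin N) :=
  univ.filter fun x => ∃ z ∈ Iset x, dist z c ≤ 1 / (N : ℝ) ^ n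

lemma card_nearWords_le (hN : 0 < N) (n : ℕ) (c : ℝ) :
    (nearWords (N := N) n c).card ≤ 4 := by
  have h : (0 : ℝ) < (N : ℝ) ^ n := by positivity
  set t : ℝ := (N : ℝ) ^ n * c
  calc (nearWords (N := N) n c).card
      ≤ (Finset.Icc (⌈t⌉ - 2) (⌊t⌋ + 1)).card := by
        refine Finset.card_le_card_of_injOn (fun x => (wordVal x : ℤ)) ?_
          ((Nat.cast_injective.comp wordVal_injective).injOn)
        intro x hx
        obtain ⟨z, hz, hzc⟩ := (Finset.mem_filter.1 hx).2
        rw [mem_Iset_iff hN] at hz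
        have hd : |(N : ℝ) ^ n * z - t| ≤ 1 := by
          rw [← mul_sub, abs_mul, abs_of_pos h, ← Real.dist_eq]
          rwa [le_div_iff₀' h] at hzc
        rw [abs_le] at hd
        rw [Finset.mem_coe, Finset.mem_Icc, sub_le_iff_le_add, Int.ceil_le,
          ← sub_le_iff_le_add, Int.le_floor]
        push_cast
        constructor <;> linarith
    _ ≤ 4 := by
        have := Int.floor_le_ceil t
        rw [Int.card_Icc]
        omega

/-- The point of the unit square whose coordinates have the base-`N` digits given by `a`. -/
def codePoint (S : Finset (Fin N × Fin N)) (a : ℕ → S) : ℝ × ℝ :=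
  (Real.ofDigits fun i => (a i).1.1, Real.ofDigits fun i => (a i).1.2)

/-- The fair product measure on the sequences over `S`. -/
def codeMeasure (S : Finset (Fin N × Fin N)) : Measure (ℕ → S) :=
  Measure.infinitePi fun _ => uniformOn Set.univ

lemma codeMeasure_cylinder {S : Finset (Fin N × Fin N)} (hS : S.Nonempty) {n : ℕ}
    (w : Fin n → S) :
    codeMeasure S {a | ∀ i : Fin n, a i = w i} = ((S.card : ENNReal)⁻¹) ^ n := by
  have : Nonempty S := hS.to_subtype
  have s₀ : S := Classical.arbitrary S
  have : ∀ _ : ℕ, IsProbabilityMeasure (uniformOn (Set.univ : Set S)) :=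
    fun _ => inferInstance
  have heq : {a : ℕ → S | ∀ i : Fin n, a i = w i} =
      Set.pi (Finset.range n) fun i => {if h : i < n then w ⟨i, h⟩ else s₀} := by
    ext a
    simp only [Set.mem_ofPred_eq, Set.mem_pi, Finset.coe_range, Set.mem_Iio,
      Set.mem_singleton_iff]
    exact ⟨fun h i hi => by rw [dif_pos hi]; exact h ⟨i, hi⟩,
      fun h i => by simpa using h i i.2⟩
  rw [heq, codeMeasure, Measure.infinitePi_pi _ fun _ _ => measurableSet_singleton _]
  simp [uniformOn_univ]

instance {S : Finset (Fin N × Fin N)} [Nonempty S] : IsProbabilityMeasure (codeMeasure S) := by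
  unfold codeMeasure
  infer_instance

lemma codeMeasure_preimage_closedBall_le (hN : 0 < N) {S : Finset (Fin N × Fin N)}
    (hS : S.Nonempty) (n : ℕ) (p : ℝ × ℝ) :
    codeMeasure S (codePoint S ⁻¹' Metric.closedBall p (1 / (N : ℝ) ^ n)) ≤
      16 * ((S.card : ENNReal)⁻¹) ^ n := by
  set A : Finset (Fin n → S) := univ.filter fun w =>
    (fun i => (w i).1.1) ∈ nearWords n p.1 ∧ (fun i => (w i).1.2) ∈ nearWords n p.2
  have hA : A.card ≤ 16 := by
    calc A.card ≤ (nearWords (N := N) n p.1 ×ˢ nearWords (N := N) n p.2).card := by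
          refine Finset.card_le_card_of_injOn
            (fun w => (fun i => (w i).1.1, fun i => (w i).1.2)) ?_ ?_
          · intro w hw
            exact Finset.mem_product.2 (Finset.mem_filter.1 hw).2
          · intro w _ w' _ h
            rw [Prod.mk.injEq] at h
            funext i
            exact Subtype.ext (Prod.ext (congrFun h.1 i) (congrFun h.2 i))
      _ ≤ 4 * 4 := by
          rw [Finset.card_product]
          exact Nat.mul_le_mul (card_nearWords_le hN n _) (card_nearWords_le hN n _)
  have hsub : codePoint S ⁻¹' Metric.closedBall p (1 / (N : ℝ) ^ n) ⊆
      ⋃ w ∈ A, {a | ∀ i : Fin n, a i = w i} := by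
    intro a ha
    rw [Set.mem_preimage, Metric.mem_closedBall, Prod.dist_eq, max_le_iff] at ha
    refine Set.mem_iUnion₂.2 ⟨fun i => a i, Finset.mem_filter.2 ⟨Finset.mem_univ _, ?_, ?_⟩,
      fun _ => rfl⟩
    · exact Finset.mem_filter.2 ⟨Finset.mem_univ _, _,
        ofDigits_mem_Iset (fun i => (a i).1.1) n, ha.1⟩
    · exact Finset.mem_filter.2 ⟨Finset.mem_univ _, _,
        ofDigits_mem_Iset (fun i => (a i).1.2) n, ha.2⟩
  calc codeMeasure S (codePoint S ⁻¹' Metric.closedBall p (1 / (N : ℝ) ^ n))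
      ≤ ∑ w ∈ A, codeMeasure S {a | ∀ i : Fin n, a i = w i} :=
        (measure_mono hsub).trans (measure_biUnion_finset_le _ _)
    _ = A.card * ((S.card : ENNReal)⁻¹) ^ n := by
        simp [codeMeasure_cylinder hS]
    _ ≤ 16 * ((S.card : ENNReal)⁻¹) ^ n := by
        gcongr
        exact_mod_cast hA

lemma measurable_codePoint (S : Finset (Fin N × Fin N)) : Measurable (codePoint S) := by
  refine Continuous.measurable ?_
  unfold codePoint
  refine Continuous.prodMk ?_ ?_ <;> refine Real.continuous_ofDigits.comp ?_ <;> fun_prop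

lemma natCast_eq_rpow_log_div_log (hN : 1 < N) {c : ℕ} (hc : 0 < c) :
    (c : ENNReal) = (N : ENNReal) ^ (Real.log c / Real.log N) := by
  have hN' : (0 : ℝ) < N := by positivity
  have hc' : (0 : ℝ) < c := by positivity
  have hlog : Real.log N ≠ 0 := (Real.log_pos (by exact_mod_cast hN)).ne'
  rw [← ENNReal.ofReal_natCast N, ENNReal.ofReal_rpow_of_pos hN', Real.rpow_def_of_pos hN',
    mul_div_cancel₀ _ hlog, Real.exp_log hc', ENNReal.ofReal_natCast]

lemma inv_pow_rpow_log_div_log (hN : 1 < N) {c : ℕ} (hc : 0 < c) (n : ℕ) :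
    (((N : ENNReal)⁻¹) ^ n) ^ (Real.log c / Real.log N) = ((c : ENNReal)⁻¹) ^ n := by
  rw [natCast_eq_rpow_log_div_log hN hc, ← ENNReal.inv_rpow, ← ENNReal.rpow_natCast,
    ← ENNReal.rpow_natCast, ← ENNReal.rpow_mul, ← ENNReal.rpow_mul, mul_comm]

lemma ofReal_one_div_pow (hN : 0 < N) (n : ℕ) :
    ENNReal.ofReal (1 / (N : ℝ) ^ n) = ((N : ENNReal)⁻¹) ^ n := by
  rw [one_div, ← inv_pow, ENNReal.ofReal_pow (by positivity),
    ENNReal.ofReal_inv_of_pos (by positivity), ENNReal.ofReal_natCast]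

lemma map_codeMeasure_le (hN : 1 < N) {S : Finset (Fin N × Fin N)} (hS : 1 < S.card)
    {s : Set (ℝ × ℝ)} (hs : Metric.ediam s ≤ 1) :
    (codeMeasure S).map (codePoint S) s ≤
      16 * S.card * Metric.ediam s ^ (Real.log S.card / Real.log N) := by
  have hN0 : 0 < N := by omega
  have hS' : S.Nonempty := Finset.card_pos.1 (by omega)
  have hS0 : (S.card : ENNReal) ≠ 0 := by exact_mod_cast hS'.card_pos.ne'
  have hball : ∀ n, Metric.ediam s ≤ ENNReal.ofReal (1 / (N : ℝ) ^ n) →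
      (codeMeasure S).map (codePoint S) s ≤ 16 * ((S.card : ENNReal)⁻¹) ^ n := by
    intro n hn
    rcases s.eq_empty_or_nonempty with rfl | ⟨p, hp⟩
    · simp
    · have hsub : s ⊆ Metric.closedBall p (1 / (N : ℝ) ^ n) := fun q hq => by
        have := (Metric.edist_le_ediam_of_mem hq hp).trans hn
        rwa [edist_dist, ENNReal.ofReal_le_ofReal_iff (by positivity)] at this
      refine (measure_mono hsub).trans ?_
      rw [Measure.map_apply (measurable_codePoint S) Metric.isClosed_closedBall.measurableSet]
      exact codeMeasure_preimage_closedBall_le hN0 hS' n p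
  have htop : Metric.ediam s ≠ ⊤ := (hs.trans_lt ENNReal.one_lt_top).ne
  rcases eq_or_ne (Metric.ediam s) 0 with h0 | h0
  · have hlim : Filter.Tendsto (fun n => 16 * ((S.card : ENNReal)⁻¹) ^ n) Filter.atTop
        (nhds (16 * 0)) := by
      refine ENNReal.Tendsto.const_mul (ENNReal.tendsto_pow_atTop_nhds_zero_of_lt_one ?_)
        (Or.inr (by simp))
      rw [ENNReal.inv_lt_one]
      exact_mod_cast hS
    refine (ge_of_tendsto' hlim fun n => hball n (by simp [h0])).trans ?_
    simp
  · have hN1 : (1 : ℝ) < N := by exact_mod_cast hN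
    obtain ⟨n, hlt, hle⟩ := exists_nat_pow_near_of_lt_one (ENNReal.toReal_pos h0 htop)
      (ENNReal.toReal_le_of_le_ofReal zero_le_one (by simpa using hs))
      (inv_pos.2 (zero_lt_one.trans hN1)) (inv_lt_one_of_one_lt₀ hN1)
    rw [inv_pow, ← one_div] at hlt hle
    have hlow : ((N : ENNReal)⁻¹) ^ (n + 1) ≤ Metric.ediam s := by
      rw [← ofReal_one_div_pow hN0]
      exact (ENNReal.ofReal_le_iff_le_toReal htop).2 hlt.le
    calc (codeMeasure S).map (codePoint S) s ≤ 16 * ((S.card : ENNReal)⁻¹) ^ n :=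
          hball n ((ENNReal.le_ofReal_iff_toReal_le htop (by positivity)).2 hle)
      _ = 16 * S.card * ((S.card : ENNReal)⁻¹) ^ (n + 1) := by
          rw [pow_succ', mul_assoc, ← mul_assoc (S.card : ENNReal),
            ENNReal.mul_inv_cancel hS0 (ENNReal.natCast_ne_top _), one_mul]
      _ = 16 * S.card *
            (((N : ENNReal)⁻¹) ^ (n + 1)) ^ (Real.log S.card / Real.log N) := by
          rw [inv_pow_rpow_log_div_log hN hS'.card_pos]
      _ ≤ _ := by
          gcongr

/-- Mass distribution principle for the set of points whose digit pairs all lie in `S`. -/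
lemma le_dimH_range_codePoint (hN : 1 < N) (S : Finset (Fin N × Fin N)) :
    ENNReal.ofReal (Real.log S.card / Real.log N) ≤ dimH (Set.range (codePoint S)) := by
  rcases Nat.lt_or_ge 1 S.card with hS | hS
  · have hS' : S.Nonempty := Finset.card_pos.1 (by omega)
    have : Nonempty S := hS'.to_subtype
    set d : ℝ := Real.log S.card / Real.log N with hd
    have hd0 : 0 ≤ d := by positivity
    have hC : (16 * S.card : ENNReal) ≠ ⊤ :=
      ENNReal.mul_ne_top (by simp) (ENNReal.natCast_ne_top _)
    have hC0 : (16 * S.card : ENNReal) ≠ 0 :=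
      mul_ne_zero (by simp) (by exact_mod_cast hS'.card_pos.ne')
    have hle : (codeMeasure S).map (codePoint S) ≤
        (16 * S.card : ENNReal) • Measure.hausdorffMeasure d := by
      refine (Measure.le_mkMetric (fun r => 16 * S.card * r ^ d) _ 1 zero_lt_one
        fun s hs => map_codeMeasure_le hN hS hs).trans ?_
      exact Measure.mkMetric_mono_smul hC hC0 (Filter.Eventually.of_forall fun _ => le_rfl)
    have hone : 1 ≤ (codeMeasure S).map (codePoint S) (Set.range (codePoint S)) := by
      refine le_trans ?_ (Measure.le_map_apply (measurable_codePoint S).aemeasurable _)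
      simp
    refine le_dimH_of_hausdorffMeasure_ne_zero (d := d.toNNReal) fun h0 => ?_
    rw [Real.coe_toNNReal _ hd0] at h0
    have := hone.trans (hle _)
    simp [h0] at this
  · have : Real.log S.card = 0 := by
      interval_cases h : S.card <;> simp
    simp [this]

lemma ediam_Qset_le (hN : 0 < N) {n : ℕ} (x y : Fin n → Fin N) :
    Metric.ediam (Qset x y) ≤ ((N : ENNReal)⁻¹) ^ n := by
  refine Metric.ediam_le fun p hp q hq => ?_
  rw [edist_dist, ← ofReal_one_div_pow hN, Prod.dist_eq]
  exact ENNReal.ofReal_le_ofReal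
    (max_le (dist_le_of_mem_Iset hp.1 hq.1) (dist_le_of_mem_Iset hp.2 hq.2))

/-- The edges of `G`, directed from `V₁` to its complement. -/
def directedEdges (G : SimpleGraph (Fin N)) (V1 : Finset (Fin N)) : Finset (Fin N × Fin N) :=
  univ.filter (V12 G V1)

lemma mem_directedEdges {G : SimpleGraph (Fin N)} {V1 : Finset (Fin N)} {v : Fin N × Fin N} :
    v ∈ directedEdges G V1 ↔ V12 G V1 v := by
  simp [directedEdges]

lemma card_directedEdges (G : SimpleGraph (Fin N)) (V1 : Finset (Fin N)) [Fintype G.edgeSet]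
    (hbip : ∀ a b : Fin N, G.Adj a b → (a ∈ V1 ↔ b ∉ V1)) :
    (directedEdges G V1).card = G.edgeFinset.card := by
  refine Finset.card_bij (fun v _ => s(v.1, v.2)) ?_ ?_ ?_
  · intro v hv
    simpa using (mem_directedEdges.1 hv).2.2
  · intro v hv w hw h
    have hv := mem_directedEdges.1 hv
    have hw := mem_directedEdges.1 hw
    rcases Sym2.eq_iff.1 h with h | h
    · exact Prod.ext h.1 h.2
    · exact absurd (h.1 ▸ hv.1) hw.2.1
  · intro e he
    induction e with
    | _ a b =>
      have hab : G.Adj a b := by simpa using he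
      by_cases ha : a ∈ V1
      · exact ⟨(a, b), mem_directedEdges.2 ⟨ha, (hbip a b hab).1 ha, hab⟩, rfl⟩
      · exact ⟨(b, a), mem_directedEdges.2 ⟨(hbip b a hab.symm).2 ha, ha, hab.symm⟩, Sym2.eq_swap⟩

/-- The squares indexed by two prefixes of length `k` followed by `m` edges of `G`, all directed
from `V₁` to its complement or all in the opposite direction. -/
def coverSquare (G : SimpleGraph (Fin N)) (V1 : Finset (Fin N)) (k m : ℕ)
    (i : (Fin k → Fin N) × (Fin k → Fin N) × Bool × (Fin m → directedEdges G V1)) :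
    Set (ℝ × ℝ) :=
  if i.2.2.1 = true then
    Qset (Fin.append i.1 fun j => (i.2.2.2 j).1.1) (Fin.append i.2.1 fun j => (i.2.2.2 j).1.2)
  else
    Qset (Fin.append i.1 fun j => (i.2.2.2 j).1.2) (Fin.append i.2.1 fun j => (i.2.2.2 j).1.1)

lemma prefixLen_le_of_ne {n k : ℕ} {x y : Fin n → Fin N} {j : Fin n} (hj : (j : ℕ) < k)
    (h : x j ≠ y j) : prefixLen x y ≤ k := by
  refine le_trans ?_ hj.le
  calc prefixLen x y ≤ (Finset.Iio j).card := by
        refine Finset.card_le_card fun i hi => Finset.mem_Iio.2 (lt_of_not_ge fun hji => ?_)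
        exact h ((Finset.mem_filter.1 hi).2 j hji)
    _ = j := Fin.card_Iio j

lemma exists_mem_coverSquare (hN : 0 < N) {G : SimpleGraph (Fin N)} {V1 : Finset (Fin N)}
    {k m : ℕ} {p : ℝ × ℝ} (hp : p ∈ Lam G V1 (k + m)) (hd : 1 / (N : ℝ) ^ k < dist p.1 p.2) :
    ∃ i, p ∈ coverSquare G V1 k m i := by
  obtain ⟨⟨x, y⟩, hxy, hpx, hpy⟩ := Set.mem_iUnion₂.1 hp
  dsimp only at hxy hpx hpy
  have hne : x ∘ Fin.castAdd m ≠ y ∘ Fin.castAdd m := fun h =>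
    hd.not_ge (dist_le_of_mem_Iset (Iset_subset_prefix hN x hpx)
      (h ▸ Iset_subset_prefix hN y hpy))
  obtain ⟨j, hj⟩ := Function.ne_iff.1 hne
  have hlen : prefixLen x y ≤ k := prefixLen_le_of_ne (j := Fin.castAdd m j) j.isLt hj
  have hle : ∀ i : Fin m, prefixLen x y ≤ (Fin.natAdd k i : Fin (k + m)) := fun i =>
    hlen.trans (Nat.le_add_right k i)
  rcases hxy with rfl | ⟨⟨t, htx, hty⟩, hadj⟩
  · exact absurd rfl hne
  · cases t with
    | true =>
      refine ⟨⟨x ∘ Fin.castAdd m, y ∘ Fin.castAdd m, true, fun i =>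
        ⟨(x (Fin.natAdd k i), y (Fin.natAdd k i)), mem_directedEdges.2 ⟨?_, ?_, ?_⟩⟩⟩, ?_⟩
      · simpa using htx _ (hle i)
      · simpa using hty _ (hle i)
      · exact hadj _ (hle i)
      · rw [coverSquare, if_pos rfl]
        refine ⟨?_, ?_⟩
        · exact (Fin.append_castAdd_natAdd (f := x)).symm ▸ hpx
        · exact (Fin.append_castAdd_natAdd (f := y)).symm ▸ hpy
    | false =>
      refine ⟨⟨x ∘ Fin.castAdd m, y ∘ Fin.castAdd m, false, fun i =>
        ⟨(y (Fin.natAdd k i), x (Fin.natAdd k i)), mem_directedEdges.2 ⟨?_, ?_, ?_⟩⟩⟩, ?_⟩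
      · simpa using hty _ (hle i)
      · simpa using htx _ (hle i)
      · exact (hadj _ (hle i)).symm
      · rw [coverSquare, if_neg (by simp)]
        refine ⟨?_, ?_⟩
        · exact (Fin.append_castAdd_natAdd (f := x)).symm ▸ hpx
        · exact (Fin.append_castAdd_natAdd (f := y)).symm ▸ hpy

lemma dimH_LamInf_dist_gt_le (hN : 1 < N) (G : SimpleGraph (Fin N)) (V1 : Finset (Fin N))
    (hS : 0 < (directedEdges G V1).card) (k : ℕ) :
    dimH {p ∈ LamInf G V1 | 1 / (N : ℝ) ^ k < dist p.1 p.2} ≤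
      ENNReal.ofReal (Real.log (directedEdges G V1).card / Real.log N) := by
  have hN0 : 0 < N := by omega
  set c := (directedEdges G V1).card with hc
  set d : ℝ := Real.log c / Real.log N with hd
  have hd0 : 0 ≤ d := by positivity
  have hN1 : (N : ENNReal)⁻¹ < 1 := by
    rw [ENNReal.inv_lt_one]
    exact_mod_cast hN
  have hc0 : (c : ENNReal) ≠ 0 := by exact_mod_cast hS.ne'
  have hdiam : ∀ m i, Metric.ediam (coverSquare G V1 k m i) ≤ ((N : ENNReal)⁻¹) ^ (k + m) := by
    intro m i
    unfold coverSquare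
    split_ifs <;> exact ediam_Qset_le hN0 _ _
  refine dimH_le_of_hausdorffMeasure_ne_top (d := d.toNNReal) (ne_top_of_le_ne_top
    (b := (N : ENNReal) ^ k * (N ^ k * 2)) (by finiteness) ?_)
  rw [Real.coe_toNNReal _ hd0]
  refine (Measure.hausdorffMeasure_le_liminf_sum d _ (l := Filter.atTop)
    (fun m => ((N : ENNReal)⁻¹) ^ (k + m)) ?_ (fun m => coverSquare G V1 k m)
    (Filter.Eventually.of_forall hdiam) ?_).trans ?_
  · exact (ENNReal.tendsto_pow_atTop_nhds_zero_of_lt_one hN1).comp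
      (Filter.tendsto_atTop_mono (fun m => Nat.le_add_left m k) Filter.tendsto_id)
  · filter_upwards [Filter.eventually_ge_atTop 1] with m hm p hp
    exact Set.mem_iUnion.2
      (exists_mem_coverSquare hN0 (Set.mem_iInter₂.1 hp.1 (k + m) (by omega)) hp.2)
  · refine (Filter.liminf_le_liminf (Filter.Eventually.of_forall fun m => ?_)).trans_eq
      (Filter.liminf_const _)
    calc ∑ i, Metric.ediam (coverSquare G V1 k m i) ^ d
        ≤ ∑ _i : (Fin k → Fin N) × (Fin k → Fin N) × Bool × (Fin m → directedEdges G V1),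
            ((c : ENNReal)⁻¹) ^ (k + m) := by
          refine Finset.sum_le_sum fun i _ => ?_
          rw [← inv_pow_rpow_log_div_log hN hS]
          gcongr
          exact hdiam m i
      _ = (N : ENNReal) ^ k * (N ^ k * 2) *
            (((c : ENNReal)⁻¹) ^ k * (c * (c : ENNReal)⁻¹) ^ m) := by
          simp only [Finset.sum_const, Finset.card_univ, Fintype.card_prod, Fintype.card_fun,
            Fintype.card_fin, Fintype.card_bool, Fintype.card_coe, nsmul_eq_mul, ← hc]
          push_cast
          ring
      _ ≤ (N : ENNReal) ^ k * (N ^ k * 2) := by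
          rw [ENNReal.mul_inv_cancel hc0 (ENNReal.natCast_ne_top _), one_pow, mul_one]
          refine mul_le_of_le_one_right' (pow_le_one' ?_ k)
          rw [ENNReal.inv_le_one]
          exact_mod_cast hS

lemma LamInf_subset_unitSq (hN : 0 < N) (G : SimpleGraph (Fin N)) (V1 : Finset (Fin N)) :
    LamInf G V1 ⊆ unitSq := by
  have hI : ∀ x : Fin 1 → Fin N, Iset x ⊆ Set.Icc 0 1 := by
    intro x z hz
    rw [mem_Iset_iff hN] at hz
    have hN' : (0 : ℝ) < (N : ℝ) ^ 1 := by positivity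
    have hval : (wordVal x : ℝ) + 1 ≤ (N : ℝ) ^ 1 := by exact_mod_cast wordVal_lt x
    exact ⟨nonneg_of_mul_nonneg_right ((Nat.cast_nonneg _).trans hz.1) hN',
      le_of_mul_le_mul_left (by linarith) hN'⟩
  intro p hp
  obtain ⟨v, -, hp1, hp2⟩ := Set.mem_iUnion₂.1 (Set.mem_iInter₂.1 hp 1 le_rfl)
  exact ⟨hI _ hp1, hI _ hp2⟩

lemma LamInf_diff_DiagSet_subset (hN : 1 < N) (G : SimpleGraph (Fin N)) (V1 : Finset (Fin N)) :
    LamInf G V1 \ DiagSet ⊆ ⋃ k : ℕ, {p ∈ LamInf G V1 | 1 / (N : ℝ) ^ k < dist p.1 p.2} := by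
  intro p hp
  have hne : p.1 ≠ p.2 := fun h =>
    hp.2 ⟨p.1, (LamInf_subset_unitSq (by omega) G V1 hp.1).1, Prod.ext rfl h⟩
  obtain ⟨k, hk⟩ := exists_pow_lt_of_lt_one (dist_pos.2 hne)
    (inv_lt_one_of_one_lt₀ (by exact_mod_cast hN : (1 : ℝ) < N))
  refine Set.mem_iUnion.2 ⟨k, hp.1, ?_⟩
  rwa [one_div, ← inv_pow]

lemma DiagSet_subset_LamInf (hN : 1 < N) (G : SimpleGraph (Fin N)) (V1 : Finset (Fin N)) :
    DiagSet ⊆ LamInf G V1 := by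
  rintro _ ⟨t, ht, rfl⟩
  obtain ⟨a, -, rfl⟩ := Real.ofDigits_SurjOn hN ht
  refine Set.mem_iInter₂.2 fun n _ => Set.mem_iUnion₂.2 ⟨(fun i => a i, fun i => a i),
    Or.inl rfl, ofDigits_mem_Iset a n, ofDigits_mem_Iset a n⟩

lemma range_codePoint_subset_LamInf (G : SimpleGraph (Fin N)) (V1 : Finset (Fin N)) :
    Set.range (codePoint (directedEdges G V1)) ⊆ LamInf G V1 := by
  rintro _ ⟨a, rfl⟩
  have ha := fun i => mem_directedEdges.1 (a i).2
  refine Set.mem_iInter₂.2 fun n _ => Set.mem_iUnion₂.2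
    ⟨(fun i => (a i).1.1, fun i => (a i).1.2), Or.inr ⟨⟨true, ?_, ?_⟩, ?_⟩,
      ofDigits_mem_Iset (fun i => (a i).1.1) n, ofDigits_mem_Iset (fun i => (a i).1.2) n⟩
  · exact fun i _ => by simpa using (ha i).1
  · exact fun i _ => by simpa using (ha i).2.1
  · exact fun i _ => (ha i).2.2

lemma finite_range_codePoint_inter_DiagSet (hN : 0 < N) (G : SimpleGraph (Fin N))
    (V1 : Finset (Fin N)) :
    (Set.range (codePoint (directedEdges G V1)) ∩ DiagSet).Finite := by
  refine (Set.finite_range fun u : Fin N => ((u : ℝ) / N, (u : ℝ) / N)).subset ?_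
  rintro _ ⟨⟨a, rfl⟩, t, -, ht⟩
  have hN' : (0 : ℝ) < N := by positivity
  have hne : (a 0).1.1 ≠ (a 0).1.2 := (mem_directedEdges.1 (a 0).2).2.2.ne
  obtain ⟨ht1, ht2⟩ := Prod.ext_iff.1 ht
  have h1 := ofDigits_mem_Iset (fun i => (a i).1.1) 1
  have h2 := ofDigits_mem_Iset (fun i => (a i).1.2) 1
  rw [← show t = Real.ofDigits fun i => (a i).1.1 from ht1] at h1
  rw [← show t = Real.ofDigits fun i => (a i).1.2 from ht2] at h2
  rw [← ht]
  simp only [Iset, Ipt, Finset.univ_unique, Fin.default_eq_zero, Fin.val_zero, zero_add, pow_one,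
    Finset.sum_singleton, Set.mem_Icc, ← add_div, div_le_iff₀' hN', le_div_iff₀' hN'] at h1 h2
  rcases lt_or_gt_of_ne hne with h | h
  · refine ⟨(a 0).1.2, ?_⟩
    have h' : ((a 0).1.1 : ℝ) + 1 ≤ ((a 0).1.2 : ℝ) := by exact_mod_cast h
    have : ((a 0).1.2 : ℝ) / N = t := by
      rw [div_eq_iff hN'.ne']
      linarith
    simp [this]
  · refine ⟨(a 0).1.1, ?_⟩
    have h' : ((a 0).1.2 : ℝ) + 1 ≤ ((a 0).1.1 : ℝ) := by exact_mod_cast h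
    have : ((a 0).1.1 : ℝ) / N = t := by
      rw [div_eq_iff hN'.ne']
      linarith
    simp [this]

lemma dimH_DiagSet : dimH DiagSet = 1 := by
  have h : Isometry fun t : ℝ => (t, t) := Isometry.of_dist_eq fun a b => by simp [Prod.dist_eq]
  rw [DiagSet, h.dimH_image, Real.dimH_of_nonempty_interior (by simp)]
  simp

lemma dimH_LamInf_diff_DiagSet (hN : 1 < N) (G : SimpleGraph (Fin N)) (V1 : Finset (Fin N))
    (hS : 0 < (directedEdges G V1).card) :
    dimH (LamInf G V1 \ DiagSet) =
      ENNReal.ofReal (Real.log (directedEdges G V1).card / Real.log N) := by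
  refine le_antisymm ?_ ?_
  · refine (dimH_mono (LamInf_diff_DiagSet_subset hN G V1)).trans ?_
    rw [dimH_iUnion]
    exact iSup_le fun k => dimH_LamInf_dist_gt_le hN G V1 hS k
  · refine (le_dimH_range_codePoint hN _).trans ?_
    rw [← Set.sdiff_union_inter (Set.range _) DiagSet, dimH_union,
      (finite_range_codePoint_inter_DiagSet (by omega) G V1).dimH_zero]
    exact max_le (dimH_mono (Set.sdiff_subset_sdiff_left (range_codePoint_subset_LamInf G V1)))
      bot_le

/-- `dim_H Λ = max{log|E|/log N, 1}` and `dim_H(Λ \ Diag) = log|E|/log N`. -/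
theorem statement7 {N : ℕ} (G : SimpleGraph (Fin N)) (V1 : Finset (Fin N))
    (hV1 : V1.Nonempty) (hV2 : V1ᶜ.Nonempty)
    (hbip : ∀ a b : Fin N, G.Adj a b → (a ∈ V1 ↔ b ∉ V1))
    (hE : G.edgeFinset.Nonempty) :
    dimH (LamInf G V1)
        = ENNReal.ofReal (max (Real.log (G.edgeFinset.card : ℝ) / Real.log (N : ℝ)) 1) ∧
      dimH (LamInf G V1 \ DiagSet)
        = ENNReal.ofReal (Real.log (G.edgeFinset.card : ℝ) / Real.log (N : ℝ)) := by
  have hN : 1 < N := by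
    obtain ⟨a, ha⟩ := hV1
    obtain ⟨b, hb⟩ := hV2
    have hab : (a : ℕ) ≠ b := fun h => Finset.mem_compl.1 hb (Fin.ext h ▸ ha)
    omega
  have hcard := card_directedEdges G V1 hbip
  have hoff := dimH_LamInf_diff_DiagSet hN G V1 (hcard ▸ hE.card_pos)
  rw [hcard] at hoff
  refine ⟨?_, hoff⟩
  rw [← Set.sdiff_union_of_subset (DiagSet_subset_LamInf hN G V1), dimH_union, hoff,
    dimH_DiagSet, ENNReal.ofReal_max, ENNReal.ofReal_one]

end HierGraph
end
end
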